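/- Let Γ be a finite additive abelian group containing an element x with x + x ≠ 0, and let χ : Fin m → Γ satisfy χ(i) ≠ 0 for all i and generate Γ (the subgroup of Γ generated by the values χ(i) is all of Γ). Then the kernel lattice L(χ) does not contain m ℤ-linearly independent nonnegative elements of degree ≤ 2; hence its full-rank degree is at least 3. (This is the lattice form of: if G is finite abelian but not an elementary abelian 2-group and V is a faithful non-modular representation, then γ_field(G,V) ≥ 3.) -/

import Mathlib

/-- The kernel lattice `L(χ) = {a : Fin m → ℤ | ∑ i, a i • χ i = 0}` of a family of
elements `χ : Fin m → Γ` of an additive abelian group. -/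
def latticeOf {m : ℕ} {Γ : Type*} [AddCommGroup Γ] (χ : Fin m → Γ) :
    AddSubgroup (Fin m → ℤ) where
  carrier := {a | ∑ i, a i • χ i = 0}
  zero_mem' := by simp
  add_mem' := by
    intro a b ha hb
    simp only [Set.mem_setOf_eq] at ha hb ⊢
    simp only [Pi.add_apply, add_smul, Finset.sum_add_distrib, ha, hb, add_zero]
  neg_mem' := by
    intro a ha
    simp only [Set.mem_setOf_eq] at ha ⊢
    simp only [Pi.neg_apply, neg_smul, Finset.sum_neg_distrib, ha, neg_zero]

/-- A nonzero nonnegative integer vector is a unit vector plus a nonnegative vector. -/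
theorem exists_eq_single_add_of_nonneg {m : ℕ} {a : Fin m → ℤ} (ha : 0 ≤ a) (hne : a ≠ 0) :
    ∃ (i : Fin m) (b : Fin m → ℤ), 0 ≤ b ∧ a = Pi.single i 1 + b ∧
      ∑ k, a k = 1 + ∑ k, b k := by
  obtain ⟨i, hi⟩ := Function.ne_iff.mp hne
  have hab : a = Pi.single i 1 + (a - Pi.single i 1) := by abel
  refine ⟨i, a - Pi.single i 1, fun k => ?_, hab, ?_⟩
  · have hk := ha k
    obtain rfl | hki := eq_or_ne k i
    · simp only [Pi.zero_apply, Pi.sub_apply, Pi.single_eq_same] at hi hk ⊢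
      omega
    · simpa [hki] using hk
  · simp

/-- A nonnegative integer vector of degree at most two is zero, a unit vector, or a sum of two
unit vectors. -/
theorem eq_zero_or_single_or_single_add_single {m : ℕ} {a : Fin m → ℤ} (ha : 0 ≤ a)
    (hdeg : ∑ k, a k ≤ 2) :
    a = 0 ∨ (∃ i, a = Pi.single i 1) ∨ ∃ i k, a = Pi.single i 1 + Pi.single k 1 := by
  by_cases h : a = 0
  · exact Or.inl h
  obtain ⟨i, b, hb, rfl, hsum⟩ := exists_eq_single_add_of_nonneg ha h
  by_cases h' : b = 0
  · exact Or.inr (Or.inl ⟨i, by simp [h']⟩)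
  obtain ⟨k, c, hc, rfl, hsum'⟩ := exists_eq_single_add_of_nonneg hb h'
  have hc_sum : ∑ l, c l = 0 :=
    le_antisymm (by linarith) (Finset.sum_nonneg fun l _ => hc l)
  have hc_zero : c = 0 := (Fintype.sum_eq_zero_iff_of_nonneg hc).mp hc_sum
  exact Or.inr (Or.inr ⟨i, k, by simp [hc_zero]⟩)

/-- An odd function on the group vanishes on every lattice element of degree at most two. -/
theorem dotProduct_eq_zero_of_mem_latticeOf {m : ℕ} {Γ : Type*} [AddCommGroup Γ]
    {χ : Fin m → Γ} (hχ : ∀ i, χ i ≠ 0) {f : Γ → ℤ} (hf : ∀ y, f (-y) = -f y)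
    {a : Fin m → ℤ} (hmem : a ∈ latticeOf χ) (ha : 0 ≤ a) (hdeg : ∑ k, a k ≤ 2) :
    a ⬝ᵥ (f ∘ χ) = 0 := by
  have hmem' : ∑ i, a i • χ i = 0 := hmem
  obtain rfl | ⟨i, rfl⟩ | ⟨i, k, rfl⟩ := eq_zero_or_single_or_single_add_single ha hdeg
  · simp
  · exact absurd (by simpa [Pi.single_apply, ite_smul] using hmem') (hχ i)
  · have hik : χ i + χ k = 0 := by
      simpa [add_smul, Finset.sum_add_distrib, Pi.single_apply, ite_smul] using hmem'
    simp [add_dotProduct, eq_neg_of_add_eq_zero_left hik, hf]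

/-- Linearly independent vectors `a₁, …, aₘ` in `ℤᵐ` are not all orthogonal to a nonzero vector. -/
theorem eq_zero_of_forall_dotProduct_eq_zero {m : ℕ} {a : Fin m → Fin m → ℤ}
    (hli : LinearIndependent ℤ a) {w : Fin m → ℤ} (hw : ∀ j, a j ⬝ᵥ w = 0) : w = 0 := by
  by_contra hne
  have hdet : (Matrix.of a).det = 0 :=
    Matrix.exists_mulVec_eq_zero_iff.mp ⟨w, hne, funext hw⟩
  obtain ⟨v, hv, hva⟩ := Matrix.exists_vecMul_eq_zero_iff.mpr hdet
  refine hv (funext (Fintype.linearIndependent_iff.mp hli v ?_))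
  rwa [Matrix.vecMul_eq_sum] at hva

/-- Let `Γ` be a finite additive abelian group containing an element `x` with
`x + x ≠ 0`, and let `χ : Fin m → Γ` have all values nonzero and generate `Γ`. Then the kernel
lattice `L(χ)` does not contain `m` `ℤ`-linearly independent nonnegative elements of degree
`≤ 2`; hence its full-rank degree is at least 3. -/
theorem stmt_5 (m : ℕ) (Γ : Type*) [AddCommGroup Γ] [Finite Γ]
    (x : Γ) (hx : x + x ≠ 0)
    (χ : Fin m → Γ) (hχ : ∀ i, χ i ≠ 0)
    (hgen : AddSubgroup.closure (Set.range χ) = ⊤) :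
    ¬ ∃ a : Fin m → (Fin m → ℤ), (∀ j, a j ∈ latticeOf χ) ∧ LinearIndependent ℤ a ∧
        (∀ j i, 0 ≤ a j i) ∧ ∀ j, ∑ i, a j i ≤ 2 := by
  classical
  rintro ⟨a, hmem, hli, hnonneg, hdeg⟩
  obtain ⟨i, hi⟩ : ∃ i, χ i + χ i ≠ 0 := by
    by_contra! h
    have hle : AddSubgroup.closure (Set.range χ) ≤ (nsmulAddMonoidHom (α := Γ) 2).ker := by
      rw [AddSubgroup.closure_le]
      rintro _ ⟨i, rfl⟩
      simpa [AddMonoidHom.mem_ker, two_nsmul] using h i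
    have hker : x ∈ (nsmulAddMonoidHom (α := Γ) 2).ker := hle (hgen ▸ AddSubgroup.mem_top x)
    exact hx (by simpa [AddMonoidHom.mem_ker, two_nsmul] using hker)
  let f : Γ → ℤ := fun y => (if y = χ i then 1 else 0) - if -y = χ i then 1 else 0
  have hf : ∀ y, f (-y) = -f y := fun y => by simp [f]
  have hzero : f ∘ χ = 0 := eq_zero_of_forall_dotProduct_eq_zero hli fun j =>
    dotProduct_eq_zero_of_mem_latticeOf hχ hf (hmem j) (hnonneg j) (hdeg j)
  have hneg : -χ i ≠ χ i := fun h => hi (neg_eq_iff_add_eq_zero.mp h)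
  simpa [f, hneg] using congrFun hzero i
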